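/- For every n ≥ 2 there exists a polynomial q_n ∈ ℚ[t] of degree π(n) such that |P(k,n)| = q_n(k) for all k ≥ n² · ∏_{m=1}^{π(n)} log_{p_m}(n) − n + 1, and the leading coefficient of q_n equals Vol(conv(M_n)) ≤ (1/π(n)!) · ∏_{j=1}^{π(n)} log_{p_j}(n). -/

import Mathlib

open Pointwise MeasureTheory

/-- `Mn n` is the set of exponent vectors `α ∈ ℕ^{π(n)}` (indexed by the primes
`p_1 < ... < p_{π(n)}` at most `n`, where `p_j = Nat.nth Nat.Prime (j-1)`)
with `∏ j, p_j ^ α_j ≤ n`. -/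
def Mn (n : ℕ) : Set (Fin (Nat.primeCounting n) → ℕ) :=
  {α | ∏ j : Fin (Nat.primeCounting n), (Nat.nth Nat.Prime (j : ℕ)) ^ (α j) ≤ n}

/-- `ksum k A` is the `k`-fold sumset `{a_1 + ... + a_k : a_i ∈ A}`. -/
def ksum {V : Type*} [AddCommMonoid V] (k : ℕ) (A : Set V) : Set V :=
  {x | ∃ f : Fin k → V, (∀ i, f i ∈ A) ∧ ∑ i, f i = x}

/-- `Pset k n` is the set of products of `k` factors from `{1, ..., n}`. -/
def Pset (k n : ℕ) : Set ℕ :=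
  {m | ∃ l : Fin n → ℕ, (∑ j, l j) = k ∧ ∏ j : Fin n, ((j : ℕ) + 1) ^ (l j) = m}

/-- `Qn n` is the convex hull of `Mn n` in `ℝ^{π(n)}`. -/
def Qn (n : ℕ) : Set (Fin (Nat.primeCounting n) → ℝ) :=
  convexHull ℝ
    ((fun (α : Fin (Nat.primeCounting n) → ℕ) (j : Fin (Nat.primeCounting n)) => (α j : ℝ)) ''
      Mn n)

/-- The simplex `{(x,y,z) ∈ ℝ³ : x,y,z ≥ 0, 6x + 10y + 15z ≤ 30}`. -/
def Q3 : Set (Fin 3 → ℝ) :=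
  {x | 0 ≤ x 0 ∧ 0 ≤ x 1 ∧ 0 ≤ x 2 ∧ 6 * x 0 + 10 * x 1 + 15 * x 2 ≤ 30}

/-- Subtracting the largest admissible multiple of `w` from a nonnegative vector `v` keeps it
nonnegative and kills one of its coordinates. -/
theorem exists_nonneg_sub_smul {ι : Type*} [Fintype ι] (v w : ι → ℝ) (hv : ∀ j, 0 ≤ v j)
    (hw : ∃ j, 0 < w j) (hvw : ∀ j, v j = 0 → w j = 0) :
    ∃ c : ℝ, 0 < c ∧ (∀ j, 0 ≤ v j - c * w j) ∧ ∃ j, v j ≠ 0 ∧ v j - c * w j = 0 := by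
  classical
  obtain ⟨j₀, hj₀⟩ := hw
  obtain ⟨i, hi, hmin⟩ := Finset.exists_min_image (Finset.univ.filter fun j => 0 < w j)
    (fun j => v j / w j) ⟨j₀, by simpa using hj₀⟩
  have hi' : 0 < w i := by simpa using hi
  have hvi : v i ≠ 0 := fun h => hi'.ne' (hvw i h)
  have hc : 0 < v i / w i := div_pos (lt_of_le_of_ne (hv i) hvi.symm) hi'
  refine ⟨v i / w i, hc, fun j => ?_, i, hvi, ?_⟩
  · rcases lt_or_ge 0 (w j) with h | h
    · have := hmin j (by simpa using h)
      rw [le_div_iff₀ h] at this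
      linarith
    · nlinarith [hv j]
  · field_simp
    simp

/-- Every nonnegative real relation between the integer vectors `A j` dominates (in support) a
nonzero natural relation whose entries are bounded by the maximal minors. -/
theorem exists_nat_relation {ι κ : Type*} [Fintype ι] [Fintype κ] [DecidableEq κ]
    (A : ι → κ → ℤ)
    (hspan : Submodule.span ℝ (Set.range fun j i => (A j i : ℝ)) = ⊤) (W : ℝ)
    (hW : ∀ σ : κ → ι, |(((Matrix.of fun i j => A (σ j) i).det : ℤ) : ℝ)| ≤ W)
    (v : ι → ℝ) (hv : ∀ j, 0 ≤ v j) (hv0 : v ≠ 0) (hker : ∀ i, ∑ j, v j * A j i = 0) :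
    ∃ u : ι → ℕ, u ≠ 0 ∧ (∀ j, v j = 0 → u j = 0) ∧ (∀ j, (u j : ℝ) ≤ W) ∧
      ∀ i, ∑ j, (u j : ℤ) * A j i = 0 := by
  classical
  induction hs : (Finset.univ.filter fun j => v j ≠ 0).card using Nat.strong_induction_on
    generalizing v with
  | _ s ih =>
  by_cases hmin : ∃ w : ι → ℝ, w ≠ 0 ∧ (∀ i, ∑ j, w j * A j i = 0) ∧ (∀ j, v j = 0 → w j = 0) ∧
      ∃ j, v j ≠ 0 ∧ w j = 0
  · obtain ⟨w, hw0, hwk, hwv, j₁, hvj₁, hwj₁⟩ := hmin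
    wlog hpos : ∃ j, 0 < w j generalizing w with H
    · refine H (-w) (by simpa using hw0) (fun i => by simp [hwk]) (fun j h => by simp [hwv j h])
        (by simp [hwj₁]) ?_
      push Not at hpos
      obtain ⟨j, hj⟩ := Function.ne_iff.1 hw0
      exact ⟨j, by simpa using lt_of_le_of_ne (hpos j) hj⟩
    obtain ⟨c, -, hc, j₂, hvj₂, hj₂⟩ := exists_nonneg_sub_smul v w hv hpos hwv
    have hsub : ∀ j, v j = 0 → v j - c * w j = 0 := fun j h => by simp [h, hwv j h]
    obtain ⟨u, hu0, huv, huW, huk⟩ := ih _ (by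
        rw [← hs]
        refine Finset.card_lt_card ((Finset.ssubset_iff_of_subset ?_).2 ⟨j₂, ?_, ?_⟩)
        · intro j
          simp only [Finset.mem_filter, Finset.mem_univ, true_and]
          exact fun h h' => h (hsub j h')
        · simpa using hvj₂
        · simpa using hj₂) (fun j => v j - c * w j) hc
      (Function.ne_iff.2 ⟨j₁, by simpa [hwj₁] using hvj₁⟩)
      (fun i => by
        simp only [sub_mul, Finset.sum_sub_distrib, hker, mul_assoc, ← Finset.mul_sum, hwk]
        simp) rfl
    exact ⟨u, hu0, fun j h => huv j (hsub j h), huW, huk⟩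
  · push Not at hmin
    obtain ⟨j₀, hj₀⟩ := Function.ne_iff.1 hv0
    replace hj₀ : v j₀ ≠ 0 := hj₀
    set a : ι → κ → ℝ := fun j i => (A j i : ℝ) with ha
    have hrel : ∀ w : ι → ℝ, ∑ j, w j • a j = 0 ↔ ∀ i, ∑ j, w j * A j i = 0 := by
      intro w
      simp [funext_iff, ha]
    have hind : ∀ b : Set ι, LinearIndepOn ℝ a b ↔
        ∀ w : ι → ℝ, (∀ i, ∑ j, w j * A j i = 0) → (∀ j ∉ b, w j = 0) → w = 0 := by
      intro b
      rw [linearIndepOn_iff]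
      constructor
      · intro h w hw hwb
        have := h (Finsupp.equivFunOnFinite.symm w) (by
          rw [Finsupp.mem_supported]
          intro j hj
          by_contra hjb
          exact (by simpa using hj : w j ≠ 0) (hwb j hjb)) (by
          rw [Finsupp.linearCombination_apply, Finsupp.sum_fintype _ _ (by simp)]
          exact (hrel w).2 hw)
        exact funext fun j => by simpa using DFunLike.congr_fun this j
      · intro h l hl hl0
        have := h l (by
          rw [← hrel]
          rw [Finsupp.linearCombination_apply, Finsupp.sum_fintype _ _ (by simp)] at hl0
          exact hl0) (fun j hj => by
          by_contra hne
          exact hj (hl (by simpa using hne)))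
        ext j
        simp [this]
    have hli : LinearIndepOn ℝ a ({j | v j ≠ 0} \ {j₀}) := by
      rw [hind]
      intro w hw hwb
      by_contra hw0
      exact hmin w hw0 hw (fun j hj => hwb j (by simp [hj])) j₀ hj₀ (hwb j₀ (by simp))
    obtain ⟨b, -, hSb, hbs, hb⟩ := exists_linearIndepOn_extension hli (Set.subset_univ _)
    rw [Set.image_univ] at hbs
    have hj₀b : j₀ ∉ b := by
      intro h
      refine hv0 ((hind b).1 hb v hker fun j hj => ?_)
      by_contra hne
      refine hj ?_
      by_cases hjj : j = j₀
      · exact hjj ▸ h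
      · exact hSb ⟨hne, hjj⟩
    have hbt : ⊤ ≤ Submodule.span ℝ (Set.range fun x : b => a x) := by
      rw [← hspan, Submodule.span_le]
      convert hbs using 2
      simp [Set.image_eq_range]
    let B := Module.Basis.mk hb hbt
    have e : κ ≃ b := (Pi.basisFun ℝ κ).indexEquiv B
    set M : Matrix κ κ ℤ := Matrix.of fun i j => A (e j) i with hM
    have hdet : M.det ≠ 0 := by
      have h1 : ((Pi.basisFun ℝ κ).toMatrix (B.reindex e.symm)).det ≠ 0 := by
        rw [← Module.Basis.det_apply]
        exact ((Pi.basisFun ℝ κ).isUnit_det _).ne_zero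
      have h2 : (Pi.basisFun ℝ κ).toMatrix (B.reindex e.symm) = M.map (Int.castRingHom ℝ) := by
        ext i j
        simp [Module.Basis.toMatrix_apply, B, hM, ha]
      rw [h2, ← RingHom.mapMatrix_apply, ← RingHom.map_det] at h1
      simpa using h1
    set x := M.cramer (A j₀) with hx
    have hxe : ∀ i, ∑ j, x j * A (e j) i = M.det * A j₀ i := by
      intro i
      have := congrFun (Matrix.mulVec_cramer M (A j₀)) i
      rw [Matrix.mulVec, dotProduct] at this
      simp only [hM, Matrix.of_apply, Pi.smul_apply, smul_eq_mul] at this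
      rw [← this]
      exact Finset.sum_congr rfl fun j _ => mul_comm _ _
    let z : ι → ℤ := fun j => if h : j ∈ b then - x (e.symm ⟨j, h⟩)
      else if j = j₀ then M.det else 0
    have hz0 : z j₀ = M.det := by simp [z, hj₀b]
    have hzb : ∀ j ∉ b, j ≠ j₀ → z j = 0 := fun j h h' => by simp [z, h, h']
    have hze : ∀ j, z (e j) = - x j := fun j => by simp [z]
    have hzk : ∀ i, ∑ j, z j * A j i = 0 := by
      intro i
      rw [← Finset.sum_filter_add_sum_filter_not _ (fun j => j ∈ b)]
      have h1 : ∑ j with j ∈ b, z j * A j i = - (M.det * A j₀ i) := by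
        rw [← hxe, ← Finset.sum_neg_distrib]
        symm
        refine Finset.sum_bij (fun j _ => (e j : ι)) (by simp) (by simp [Subtype.ext_iff.symm])
          ?_ (fun j _ => by simp [hze])
        intro j hj
        exact ⟨e.symm ⟨j, by simpa using hj⟩, by simp⟩
      have h2 : ∑ j with j ∉ b, z j * A j i = M.det * A j₀ i := by
        rw [Finset.sum_eq_single j₀, hz0]
        · intro j hj hne
          rw [hzb j (by simpa using hj) hne, zero_mul]
        · simp [hj₀b]
      rw [h1, h2]
      ring
    have hprop : ∀ j, (M.det : ℝ) * v j = v j₀ * z j := by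
      have := (hind b).1 hb (fun j => (M.det : ℝ) * v j - v j₀ * z j) (fun i => by
          have h3 : ∑ j, (z j : ℝ) * A j i = 0 := by exact_mod_cast hzk i
          simp only [sub_mul, Finset.sum_sub_distrib, mul_assoc, ← Finset.mul_sum, hker, h3]
          simp) (fun j hj => by
          by_cases hjj : j = j₀
          · rw [hjj, hz0]; ring
          · rw [hzb j hj hjj]
            have : v j = 0 := by
              by_contra hne
              exact hj (hSb ⟨hne, hjj⟩)
            simp [this])
      intro j
      have := congrFun this j
      simp only [Pi.zero_apply] at this
      linarith
    have hvpos : 0 < v j₀ := lt_of_le_of_ne (hv j₀) (Ne.symm hj₀)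
    have hdW : |(M.det : ℝ)| ≤ W := hW fun j => e j
    refine ⟨fun j => (z j).natAbs, ?_, ?_, ?_, ?_⟩
    · refine Function.ne_iff.2 ⟨j₀, ?_⟩
      simpa [hz0] using hdet
    · intro j hj
      have := hprop j
      rw [hj, mul_zero, eq_comm, mul_eq_zero] at this
      simpa [hj₀] using this
    · intro j
      rw [Nat.cast_natAbs, Int.cast_abs]
      by_cases hjb : j ∈ b
      · obtain ⟨i, hi⟩ := e.surjective ⟨j, hjb⟩
        have hij : j = e i := by rw [hi]
        rw [hij, hze, hx, Matrix.cramer_apply]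
        rw [Int.cast_neg, abs_neg]
        have hcol : M.updateCol i (A j₀) =
            Matrix.of fun r c => A (Function.update (fun j => (e j : ι)) i j₀ c) r := by
          ext r c
          simp only [Matrix.updateCol_apply, hM, Matrix.of_apply, Function.update_apply]
          split_ifs <;> rfl
        rw [hcol]
        exact hW _
      · by_cases hjj : j = j₀
        · rw [hjj, hz0]; exact hdW
        · rw [hzb j hjb hjj]
          simpa using (abs_nonneg _).trans hdW
    · intro i
      rcases lt_or_gt_of_ne hdet with hd | hd
      · have : ∀ j, ((z j).natAbs : ℤ) = - z j := by
          intro j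
          have h1 := hprop j
          have h2 : (M.det : ℝ) < 0 := by exact_mod_cast hd
          have h3 : (z j : ℝ) ≤ 0 := by
            by_contra! h
            nlinarith [mul_pos hvpos h, mul_nonpos_of_nonpos_of_nonneg h2.le (hv j)]
          have h4 : z j ≤ 0 := by exact_mod_cast h3
          omega
        simp only [this, neg_mul, Finset.sum_neg_distrib, hzk, neg_zero]
      · have : ∀ j, ((z j).natAbs : ℤ) = z j := by
          intro j
          have h1 := hprop j
          have h2 : 0 < (M.det : ℝ) := by exact_mod_cast hd
          have h3 : 0 ≤ (z j : ℝ) := by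
            by_contra! h
            nlinarith [mul_neg_of_pos_of_neg hvpos h, mul_nonneg h2.le (hv j)]
          have h4 : 0 ≤ z j := by exact_mod_cast h3
          omega
        simp only [this, hzk]

/-- A nonnegative relation that dominates no nonzero natural relation with entries at most `W` has
entries at most `W` times the size of its support. -/
theorem le_card_support_mul_of_primitive {ι κ : Type*} [Fintype ι] [Fintype κ] [DecidableEq κ]
    (A : ι → κ → ℤ)
    (hspan : Submodule.span ℝ (Set.range fun j i => (A j i : ℝ)) = ⊤) (W : ℝ)
    (hW : ∀ σ : κ → ι, |(((Matrix.of fun i j => A (σ j) i).det : ℤ) : ℝ)| ≤ W) (hW0 : 0 ≤ W)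
    (v : ι → ℝ) (hv : ∀ j, 0 ≤ v j) (hker : ∀ i, ∑ j, v j * A j i = 0)
    (hprim : ∀ u : ι → ℕ, u ≠ 0 → (∀ i, ∑ j, (u j : ℤ) * A j i = 0) → (∀ j, (u j : ℝ) ≤ v j) →
      ∃ j, W < u j) (j : ι) :
    v j ≤ (Finset.univ.filter fun j => v j ≠ 0).card * W := by
  classical
  induction hs : (Finset.univ.filter fun j => v j ≠ 0).card using Nat.strong_induction_on
    generalizing v with
  | _ s ih =>
  by_cases hv0 : v = 0
  · rw [hv0]
    simp only [Pi.zero_apply]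
    positivity
  obtain ⟨u, hu0, huv, huW, huk⟩ := exists_nat_relation A hspan W hW v hv hv0 hker
  have hupos : ∃ j, 0 < (u j : ℝ) := by
    obtain ⟨j, hj⟩ := Function.ne_iff.1 hu0
    exact ⟨j, by exact_mod_cast Nat.pos_of_ne_zero hj⟩
  obtain ⟨c, hc0, hc, j₂, hvj₂, hj₂⟩ := exists_nonneg_sub_smul v (fun j => (u j : ℝ)) hv hupos
    (fun j h => by simp [huv j h])
  have hc1 : c < 1 := by
    by_contra! h
    obtain ⟨j, hj⟩ := hprim u hu0 huk fun j => by
      nlinarith [hc j, (Nat.cast_nonneg (u j) : (0 : ℝ) ≤ u j)]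
    exact absurd (huW j) (not_le.2 hj)
  have hlt : (Finset.univ.filter fun j => v j - c * u j ≠ 0).card < s := by
    rw [← hs]
    refine Finset.card_lt_card ((Finset.ssubset_iff_of_subset ?_).2 ⟨j₂, ?_, ?_⟩)
    · intro j
      simp only [Finset.mem_filter, Finset.mem_univ, true_and]
      exact fun h h' => h (by simp [huv j h', h'])
    · simpa using hvj₂
    · simpa using hj₂
  have hle := ih _ hlt (fun j => v j - c * u j) hc (fun i => by
      have h3 : ∑ j, (u j : ℝ) * A j i = 0 := by exact_mod_cast huk i
      simp only [sub_mul, Finset.sum_sub_distrib, mul_assoc, ← Finset.mul_sum, hker, h3]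
      simp) (fun w hw0 hwk hwv => hprim w hw0 hwk fun j => (hwv j).trans (by
        have : 0 ≤ c * (u j : ℝ) := by positivity
        linarith)) rfl
  have h1 : ((Finset.univ.filter fun j => v j - c * u j ≠ 0).card : ℝ) + 1 ≤ s := by
    exact_mod_cast hlt
  have h2 : c * u j ≤ W := by
    nlinarith [huW j, (Nat.cast_nonneg (u j) : (0 : ℝ) ≤ u j)]
  nlinarith

/-- The combination of the vectors `A j` with natural coefficients `l j`. -/
def natComb {ι V : Type*} [Fintype ι] [AddCommMonoid V] (A : ι → V) : (ι → ℕ) →+ V where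
  toFun l := ∑ j, l j • A j
  map_zero' := by simp
  map_add' l m := by simp [add_smul, Finset.sum_add_distrib]

theorem natComb_apply {ι V : Type*} [Fintype ι] [AddCommMonoid V] (A : ι → V) (l : ι → ℕ) :
    natComb A l = ∑ j, l j • A j := rfl

/-- A coefficient vector is reducible if a lexicographically smaller one has the same
combination. -/
def IsReducible {n : ℕ} {V : Type*} [AddCommMonoid V] (A : Fin n → V) (l : Fin n → ℕ) : Prop :=
  ∃ l', natComb A l' = natComb A l ∧ toLex l' < toLex l

theorem IsReducible.mono {n : ℕ} {V : Type*} [AddCommMonoid V] {A : Fin n → V}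
    {l m : Fin n → ℕ} (h : IsReducible A l) (hlm : l ≤ m) : IsReducible A m := by
  obtain ⟨l', h1, h2⟩ := h
  have hm : m = l + (m - l) := (add_tsub_cancel_of_le hlm).symm
  refine ⟨l' + (m - l), ?_, ?_⟩
  · conv_rhs => rw [hm]
    rw [map_add, map_add, h1]
  · conv_rhs => rw [hm]
    rw [toLex_add, toLex_add]
    exact add_lt_add_left h2 _

theorem injOn_natComb_not_isReducible {n : ℕ} {V : Type*} [AddCommMonoid V] (A : Fin n → V) :
    Set.InjOn (natComb A) {l | ¬ IsReducible A l} := by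
  intro l hl m hm h
  rcases lt_trichotomy (toLex l) (toLex m) with hlt | heq | hgt
  · exact absurd ⟨l, h, hlt⟩ hm
  · exact toLex.injective heq
  · exact absurd ⟨m, h.symm, hgt⟩ hl

theorem exists_not_isReducible {n : ℕ} {V : Type*} [AddCommMonoid V] (A : Fin n → V)
    (l : Fin n → ℕ) : ∃ m, natComb A m = natComb A l ∧ ¬ IsReducible A m := by
  obtain ⟨m, hm, hmin⟩ := (wellFounded_lt (α := Lex (Fin n → ℕ))).has_min
    {m | natComb A (ofLex m) = natComb A l} ⟨toLex l, rfl⟩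
  refine ⟨ofLex m, hm, fun ⟨l', h1, h2⟩ => hmin (toLex l') (h1.trans hm) h2⟩

theorem sum_eq_of_natComb_eq {ι κ : Type*} [Fintype ι] (A : ι → κ → ℤ) (i₀ : κ)
    (hA : ∀ j, A j i₀ = 1) {l m : ι → ℕ} (h : natComb A l = natComb A m) :
    ∑ j, l j = ∑ j, m j := by
  have := congrFun h i₀
  simp only [natComb_apply, Finset.sum_apply, Pi.smul_apply, hA] at this
  simp only [nsmul_eq_mul, mul_one] at this
  exact_mod_cast this

theorem eq_of_le_of_sum_eq {ι : Type*} [Fintype ι] {l m : ι → ℕ} (h : l ≤ m)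
    (hs : ∑ j, l j = ∑ j, m j) : l = m :=
  funext fun j => (Finset.sum_eq_sum_iff_of_le fun j _ => h j).1 hs j (Finset.mem_univ j)

/-- The determinant bound is insensitive to changing the sign of some of the vectors. -/
theorem abs_det_sumElim_neg_le {ι κ : Type*} [Fintype κ] [DecidableEq κ]
    (A : ι → κ → ℤ) (W : ℝ)
    (hW : ∀ σ : κ → ι, |(((Matrix.of fun i j => A (σ j) i).det : ℤ) : ℝ)| ≤ W)
    (σ : κ → ι ⊕ ι) :
    |(((Matrix.of fun i j => (Sum.elim A (-A) (σ j) : κ → ℤ) i).det : ℤ) : ℝ)| ≤ W := by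
  have h : (Matrix.of fun i j => (Sum.elim A (-A) (σ j) : κ → ℤ) i) =
      Matrix.of fun i j => (Sum.elim (fun _ => 1) (fun _ => -1) (σ j) : ℤ) *
        (Matrix.of fun i j => A (Sum.elim id id (σ j)) i) i j := by
    ext i j
    rcases hj : σ j with x | x <;> simp [hj]
  have h1 : |∏ j, (Sum.elim (fun _ => 1) (fun _ => -1) (σ j) : ℤ)| = 1 := by
    rw [Finset.abs_prod]
    refine Finset.prod_eq_one fun j _ => ?_
    rcases hj : σ j with x | x <;> simp
  rw [h, Matrix.det_mul_row, ← Int.cast_abs, abs_mul, h1, one_mul, Int.cast_abs]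
  exact hW _

/-- A reducible coefficient vector with a large entry is not minimal among reducible vectors. -/
theorem IsReducible.exists_lt {n : ℕ} {κ : Type*} [Fintype κ] [DecidableEq κ]
    (A : Fin n → κ → ℤ) (i₀ : κ) (hA : ∀ j, A j i₀ = 1)
    (hspan : Submodule.span ℝ (Set.range fun j i => (A j i : ℝ)) = ⊤) (W : ℝ) (hW0 : 0 ≤ W)
    (hW : ∀ σ : κ → Fin n, |(((Matrix.of fun i j => A (σ j) i).det : ℤ) : ℝ)| ≤ W)
    {l : Fin n → ℕ} (hl : IsReducible A l) {j₀ : Fin n} (hj₀ : n * W < l j₀) :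
    ∃ m < l, IsReducible A m := by
  classical
  obtain ⟨l', hll, hlt⟩ := hl
  by_cases hdisj : ∃ i, l i ≠ 0 ∧ l' i ≠ 0
  · obtain ⟨i, hi, hi'⟩ := hdisj
    have hl1 : l = (l - Pi.single i 1) + Pi.single i 1 := by
      refine (tsub_add_cancel_of_le fun j => ?_).symm
      rcases eq_or_ne j i with rfl | h
      · simpa using Nat.one_le_iff_ne_zero.2 hi
      · simp [h]
    have hl1' : l' = (l' - Pi.single i 1) + Pi.single i 1 := by
      refine (tsub_add_cancel_of_le fun j => ?_).symm
      rcases eq_or_ne j i with rfl | h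
      · simpa using Nat.one_le_iff_ne_zero.2 hi'
      · simp [h]
    refine ⟨l - Pi.single i 1, ?_, l' - Pi.single i 1, ?_, ?_⟩
    · refine lt_of_le_of_ne tsub_le_self fun h => ?_
      have := congrFun h i
      simp at this
      omega
    · rw [hl1, hl1', map_add, map_add] at hll
      exact add_right_cancel hll
    · rw [hl1, hl1', toLex_add, toLex_add] at hlt
      exact lt_of_add_lt_add_right hlt
  push Not at hdisj
  have hsum := sum_eq_of_natComb_eq A i₀ hA hll
  set v : Fin n ⊕ Fin n → ℝ := fun j => ((Sum.elim l l' j : ℕ) : ℝ) with hv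
  set A' : Fin n ⊕ Fin n → κ → ℤ := Sum.elim A (-A) with hA'
  have hker' : ∀ u₁ u₂ : Fin n → ℕ, (∀ i, ∑ j, ((Sum.elim u₁ u₂ j : ℕ) : ℤ) * A' j i = 0) ↔
      natComb A u₂ = natComb A u₁ := by
    intro u₁ u₂
    simp only [hA', Fintype.sum_sum_type, natComb_apply, funext_iff, Finset.sum_apply,
      Pi.smul_apply, Sum.elim_inl, Sum.elim_inr, Pi.neg_apply, mul_neg, Finset.sum_neg_distrib]
    simp only [nsmul_eq_mul]
    refine forall_congr' fun i => ?_
    rw [← sub_eq_add_neg, sub_eq_zero, eq_comm]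
  have hsupp : (Finset.univ.filter fun j => v j ≠ 0).card ≤ n := by
    refine (Finset.card_le_card_of_injOn (t := Finset.univ) (Sum.elim id id) (by simp) ?_).trans
      (Finset.card_fin n).le
    rintro (a | a) ha (b | b) hb hab <;> simp [hv] at ha hb hab
    · rw [hab]
    · subst hab; exact absurd (hdisj a ha) hb
    · subst hab; exact absurd (hdisj a hb) ha
    · rw [hab]
  obtain ⟨u, hu0, huk, huv, huW⟩ : ∃ u : Fin n ⊕ Fin n → ℕ, u ≠ 0 ∧
      (∀ i, ∑ j, (u j : ℤ) * A' j i = 0) ∧ (∀ j, (u j : ℝ) ≤ v j) ∧ ∀ j, u j ≤ W := by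
    by_contra! hcon
    have := le_card_support_mul_of_primitive A' (top_unique ?_) W
      (abs_det_sumElim_neg_le A W hW) hW0 v (fun j => by simp [hv]) ?_ hcon (Sum.inl j₀)
    · have h2 : ((Finset.univ.filter fun j => v j ≠ 0).card : ℝ) * W ≤ n * W := by gcongr
      simp only [hv, Sum.elim_inl] at this
      linarith
    · rw [← hspan]
      refine Submodule.span_mono ?_
      rintro _ ⟨j, rfl⟩
      exact ⟨Sum.inl j, by simp [hA']⟩
    · intro i
      have := (hker' l l').2 hll i
      simp only [hv]
      exact_mod_cast this
  obtain ⟨u₁, u₂, rfl⟩ : ∃ u₁ u₂ : Fin n → ℕ, u = Sum.elim u₁ u₂ :=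
    ⟨u ∘ Sum.inl, u ∘ Sum.inr, by simp⟩
  rw [hker'] at huk
  have h1 : u₁ ≤ l := fun j => by simpa [hv] using huv (Sum.inl j)
  have h2 : u₂ ≤ l' := fun j => by simpa [hv] using huv (Sum.inr j)
  have hus := sum_eq_of_natComb_eq A i₀ hA huk
  have hl1 : (l - u₁) + u₁ = l := tsub_add_cancel_of_le h1
  have hl2 : (l' - u₂) + u₂ = l' := tsub_add_cancel_of_le h2
  rcases lt_trichotomy (toLex u₂) (toLex u₁) with h | h | h
  · refine ⟨u₁, lt_of_le_of_ne h1 ?_, u₂, huk, h⟩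
    rintro rfl
    have : u₂ = l' := eq_of_le_of_sum_eq h2 (hus.trans hsum.symm)
    have hn : (1 : ℝ) ≤ n := by exact_mod_cast j₀.pos
    have := huW (Sum.inl j₀)
    simp only [Sum.elim_inl] at this
    nlinarith
  · have h := toLex.injective h
    subst h
    refine absurd (funext fun j => ?_) hu0
    have : u₂ = 0 := by
      ext i
      have h3 : u₂ i ≤ l i := h1 i
      have h4 : u₂ i ≤ l' i := h2 i
      have h5 := hdisj i
      simp only [Pi.zero_apply]
      by_cases h6 : l i = 0
      · omega
      · have := h5 h6; omega
    rcases j with j | j <;> simp [this]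
  · refine ⟨l - u₁, lt_of_le_of_ne tsub_le_self ?_, l' - u₂, ?_, ?_⟩
    · intro h3
      have h4 : u₁ = 0 := by
        rw [h3] at hl1
        simpa using hl1
      rw [h4] at hus h
      have h5 : 0 = u₂ := eq_of_le_of_sum_eq (zero_le) hus.symm
      rw [h5] at h
      exact lt_irrefl _ h
    · rw [← hl1, ← hl2, map_add, map_add, huk] at hll
      exact add_right_cancel hll
    · by_contra h3
      rw [← hl1, ← hl2, toLex_add, toLex_add] at hlt
      exact (add_lt_add_of_le_of_lt (not_lt.1 h3) h).not_gt hlt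

/-- Reducibility only depends on the entries truncated at `n * W`. -/
theorem isReducible_inf_iff {n : ℕ} {κ : Type*} [Fintype κ] [DecidableEq κ]
    (A : Fin n → κ → ℤ) (i₀ : κ) (hA : ∀ j, A j i₀ = 1)
    (hspan : Submodule.span ℝ (Set.range fun j i => (A j i : ℝ)) = ⊤) (W : ℝ) (hW0 : 0 ≤ W)
    (hW : ∀ σ : κ → Fin n, |(((Matrix.of fun i j => A (σ j) i).det : ℤ) : ℝ)| ≤ W)
    (l : Fin n → ℕ) :
    IsReducible A (fun j => min (l j) ⌊n * W⌋₊) ↔ IsReducible A l := by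
  refine ⟨fun h => h.mono fun j => min_le_left _ _, fun h => ?_⟩
  obtain ⟨m, ⟨hm, hml⟩, hmin⟩ := (wellFounded_lt (α := Fin n → ℕ)).has_min
    {m | IsReducible A m ∧ m ≤ l} ⟨l, h, le_rfl⟩
  refine hm.mono fun j => le_min (hml j) (Nat.le_floor ?_)
  by_contra! hj
  obtain ⟨m', hlt, hm'⟩ := hm.exists_lt A i₀ hA hspan W hW0 hW hj
  exact hmin m' ⟨hm', hlt.le.trans hml⟩ hlt

/-- The binomial coefficient `choose (k + r - s) r`, as a polynomial in `k`. -/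
theorem exists_polynomial_choose (r s : ℕ) :
    ∃ q : Polynomial ℚ, ∀ k : ℕ, s ≤ k + r → (((k + r - s).choose r : ℕ) : ℚ) = q.eval (k : ℚ) := by
  refine ⟨Polynomial.C ((r.factorial : ℚ)⁻¹) *
    (descPochhammer ℚ r).comp (Polynomial.X + Polynomial.C ((r : ℚ) - s)), fun k hk => ?_⟩
  have h : (k : ℚ) + (r - s) = ((k + r - s : ℕ) : ℚ) := by
    push_cast [Nat.cast_sub hk]
    ring
  simp only [Polynomial.eval_mul, Polynomial.eval_C, Polynomial.eval_comp, Polynomial.eval_add,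
    Polynomial.eval_X]
  rw [h, descPochhammer_eval_eq_descFactorial, Nat.choose_eq_descFactorial_div_factorial,
    Nat.cast_div (Nat.factorial_dvd_descFactorial _ _) (by positivity)]
  field_simp

theorem exists_polynomial_ncard_fiber {ι : Type*} [Fintype ι] (b : ℕ) (c : ι → ℕ)
    (hc : ∀ j, c j ≤ b) :
    ∃ q : Polynomial ℚ, ∀ k : ℕ, Fintype.card ι * b + 1 ≤ k + Fintype.card ι →
      (({l : ι → ℕ | ∑ j, l j = k ∧ ∀ j, min (l j) b = c j}.ncard : ℕ) : ℚ) =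
        q.eval (k : ℚ) := by
  classical
  set T : Finset ι := Finset.univ.filter fun j => c j = b with hT
  have hcard : ∑ j, c j + Fintype.card ι ≤ Fintype.card ι * b + T.card := by
    have h1 : ∑ j, (c j + 1) ≤ ∑ j, (b + if c j = b then 1 else 0) := by
      refine Finset.sum_le_sum fun j _ => ?_
      have := hc j
      split_ifs <;> omega
    simpa [Finset.sum_add_distrib, hT] using h1
  have hle : ∀ l : ι → ℕ, (∀ j, min (l j) b = c j) → c ≤ l := fun l hl j => by
    rw [← hl]; exact min_le_left _ _
  have hmem : ∀ j, j ∈ T ↔ c j = b := by simp [hT]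
  rcases Nat.eq_zero_or_pos T.card with hT0 | hT0
  · refine ⟨0, fun k hk => ?_⟩
    have : {l : ι → ℕ | ∑ j, l j = k ∧ ∀ j, min (l j) b = c j} = ∅ := by
      refine Set.eq_empty_of_forall_notMem fun l hl => ?_
      have hlc : ∀ j, l j = c j := fun j => by
        have h1 : j ∉ T := by rw [Finset.card_eq_zero.1 hT0]; simp
        rw [hmem] at h1
        have := hl.2 j
        omega
      have := hl.1
      simp only [hlc] at this
      omega
    simp [this]
  · obtain ⟨q, hq⟩ := exists_polynomial_choose (T.card - 1) (∑ j, c j)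
    refine ⟨q, fun k hk => ?_⟩
    rw [← hq k (by omega)]
    congr 1
    by_cases hk' : ∑ j, c j ≤ k
    · have himg : {l : ι → ℕ | ∑ j, l j = k ∧ ∀ j, min (l j) b = c j} =
          (fun f : ι →₀ ℕ => c + ⇑f) '' (Finset.finsuppAntidiag T (k - ∑ j, c j) : Set (ι →₀ ℕ)) := by
        ext l
        simp only [Set.mem_ofPred_eq, Set.mem_image, Finset.mem_coe, Finset.mem_finsuppAntidiag]
        constructor
        · rintro ⟨h1, h2⟩
          have h3 : c + (l - c) = l := add_tsub_cancel_of_le (hle l h2)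
          have h5 : ∀ j ∉ T, l j - c j = 0 := fun j hj => by
            rw [hmem] at hj
            have := h2 j
            omega
          refine ⟨Finsupp.equivFunOnFinite.symm (l - c), ⟨?_, ?_⟩, by simpa using h3⟩
          · have h4 : ∑ j, c j + ∑ j, (l j - c j) = k := by
              rw [← h1, ← Finset.sum_add_distrib]
              exact Finset.sum_congr rfl fun j _ => congrFun h3 j
            rw [Finset.sum_subset (Finset.subset_univ T) (fun j _ hj => by simpa using h5 j hj)]
            simp only [Finsupp.equivFunOnFinite_symm_apply_apply, Pi.sub_apply]
            omega
          · intro j hj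
            by_contra hjT
            simp [h5 j hjT] at hj
        · rintro ⟨f, ⟨h1, h2⟩, rfl⟩
          have h3 : ∀ j ∉ T, f j = 0 := fun j hj => by
            by_contra h
            exact hj (h2 (by simpa using h))
          rw [Finset.sum_subset (Finset.subset_univ T) (fun j _ hj => h3 j hj)] at h1
          refine ⟨?_, fun j => ?_⟩
          · simp only [Pi.add_apply, Finset.sum_add_distrib]
            omega
          · simp only [Pi.add_apply]
            by_cases hj : j ∈ T
            · rw [hmem] at hj; omega
            · have := h3 j hj
              have := hc j
              omega
      rw [himg, Set.ncard_image_of_injective _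
        (fun f g h => DFunLike.coe_injective (add_left_cancel h)), Set.ncard_coe_finset,
        Finset.card_finsuppAntidiag_nat_eq_choose]
      have h6 : k + (T.card - 1) - ∑ j, c j = T.card + (k - ∑ j, c j) - 1 := by omega
      rw [h6, ← Nat.choose_symm (by omega)]
      congr 1
      omega
    · have : {l : ι → ℕ | ∑ j, l j = k ∧ ∀ j, min (l j) b = c j} = ∅ := by
        refine Set.eq_empty_of_forall_notMem fun l hl => hk' ?_
        rw [← hl.1]
        exact Finset.sum_le_sum fun j _ => hle l hl.2 j
      rw [this, Set.ncard_empty, Nat.choose_eq_zero_of_lt (by omega)]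

/-- A set of coefficient vectors which only depends on the entries truncated at `b` has a
polynomial counting function. -/
theorem exists_polynomial_ncard {ι : Type*} [Fintype ι] (b : ℕ) (D : Set (ι → ℕ))
    (hD : ∀ l, (fun j => min (l j) b) ∈ D ↔ l ∈ D) :
    ∃ q : Polynomial ℚ, ∀ k : ℕ, Fintype.card ι * b + 1 ≤ k + Fintype.card ι →
      (({l : ι → ℕ | l ∈ D ∧ ∑ j, l j = k}.ncard : ℕ) : ℚ) = q.eval (k : ℚ) := by
  classical
  choose! q hq using exists_polynomial_ncard_fiber (ι := ι) b
  set C : Finset (ι → ℕ) := (Fintype.piFinset fun _ => Finset.range (b + 1)).filter (· ∈ D)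
    with hC
  refine ⟨∑ c ∈ C, q c, fun k hk => ?_⟩
  have hfin : ∀ c : ι → ℕ, {l : ι → ℕ | ∑ j, l j = k ∧ ∀ j, min (l j) b = c j}.Finite := fun c =>
    (Set.finite_Iic (fun _ : ι => k)).subset fun l hl j => by
      rw [← hl.1]
      exact Finset.single_le_sum (fun _ _ => Nat.zero_le _) (Finset.mem_univ j)
  have hU : {l : ι → ℕ | l ∈ D ∧ ∑ j, l j = k} =
      (C.biUnion fun c => (hfin c).toFinset : Finset (ι → ℕ)) := by
    ext l
    simp only [Set.mem_ofPred_eq, Finset.coe_biUnion, Set.Finite.coe_toFinset, Set.mem_iUnion, hC,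
      Finset.mem_coe, Finset.mem_filter, Fintype.mem_piFinset, Finset.mem_range, exists_prop]
    constructor
    · rintro ⟨h1, h2⟩
      exact ⟨fun j => min (l j) b, ⟨fun j => Nat.lt_succ_iff.2 (min_le_right _ _), (hD l).2 h1⟩,
        h2, fun j => rfl⟩
    · rintro ⟨c, ⟨-, h1⟩, h2, h3⟩
      refine ⟨(hD l).1 ?_, h2⟩
      rwa [funext h3]
  rw [hU, Set.ncard_coe_finset, Finset.card_biUnion]
  · rw [Nat.cast_sum, Polynomial.eval_finsetSum]
    refine Finset.sum_congr rfl fun c hc => ?_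
    rw [← hq c (fun j => ?_) k hk, Set.ncard_eq_toFinset_card _ (hfin c)]
    simp only [hC, Finset.mem_filter, Fintype.mem_piFinset, Finset.mem_range] at hc
    exact Nat.lt_succ_iff.1 (hc.1 j)
  · intro c _ c' _ hne
    rw [Function.onFun, Finset.disjoint_left]
    intro l hl hl'
    simp only [Set.Finite.mem_toFinset, Set.mem_ofPred_eq] at hl hl'
    exact hne (funext fun j => (hl.2 j).symm.trans (hl'.2 j))

/-- Effective Khovanskii theorem for a finite family of integer vectors lying on the hyperplane
where the coordinate `i₀` is one, in terms of a bound `W` on the maximal minors. -/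
theorem exists_polynomial_ncard_natComb {n : ℕ} {κ : Type*} [Fintype κ] [DecidableEq κ]
    (A : Fin n → κ → ℤ) (i₀ : κ) (hA : ∀ j, A j i₀ = 1)
    (hspan : Submodule.span ℝ (Set.range fun j i => (A j i : ℝ)) = ⊤) (W : ℝ) (hW0 : 0 ≤ W)
    (hW : ∀ σ : κ → Fin n, |(((Matrix.of fun i j => A (σ j) i).det : ℤ) : ℝ)| ≤ W) :
    ∃ q : Polynomial ℚ, ∀ k : ℕ, (n : ℝ) ^ 2 * W - n + 1 ≤ k →
      (((natComb A '' {l | ∑ j, l j = k}).ncard : ℕ) : ℚ) = q.eval (k : ℚ) := by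
  obtain ⟨q, hq⟩ := exists_polynomial_ncard ⌊n * W⌋₊ {l | ¬ IsReducible A l}
    fun l => not_congr (isReducible_inf_iff A i₀ hA hspan W hW0 hW l)
  refine ⟨q, fun k hk => ?_⟩
  rw [← hq k]
  · have himg : natComb A '' {l | ∑ j, l j = k} =
        natComb A '' {l | l ∈ {l | ¬ IsReducible A l} ∧ ∑ j, l j = k} := by
      ext x
      constructor
      · rintro ⟨l, hl, rfl⟩
        obtain ⟨m, hm, hmr⟩ := exists_not_isReducible A l
        exact ⟨m, ⟨hmr, (sum_eq_of_natComb_eq A i₀ hA hm).trans hl⟩, hm⟩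
      · rintro ⟨l, ⟨-, hl⟩, rfl⟩
        exact ⟨l, hl, rfl⟩
    rw [himg]
    exact congrArg _ ((injOn_natComb_not_isReducible A).mono fun l hl => hl.1).ncard_image
  · have h1 : (⌊n * W⌋₊ : ℝ) ≤ n * W := Nat.floor_le (by positivity)
    have h2 : (n : ℝ) * ⌊n * W⌋₊ ≤ n * (n * W) := by gcongr
    rw [Fintype.card_fin]
    have : (n : ℝ) * ⌊n * W⌋₊ + 1 ≤ k + n := by linarith
    exact_mod_cast this

theorem abs_det_le_prod_sum_abs {κ : Type*} [Fintype κ] [DecidableEq κ] (M : Matrix κ κ ℝ) :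
    |M.det| ≤ ∏ j, ∑ i, |M i j| := by
  rw [Matrix.det_apply, Fintype.prod_sum]
  refine (Finset.abs_sum_le_sum_abs _ _).trans ?_
  have h : ∀ σ : Equiv.Perm κ, |Equiv.Perm.sign σ • ∏ i, M (σ i) i| = ∏ i, |M (σ i) i| := by
    intro σ
    rw [Units.smul_def, zsmul_eq_mul, abs_mul, Finset.abs_prod]
    rcases Int.units_eq_one_or (Equiv.Perm.sign σ) with h | h <;> simp [h]
  simp only [h]
  rw [← Finset.sum_image (s := Finset.univ) (g := fun σ : Equiv.Perm κ => (σ : κ → κ))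
    (f := fun f => ∏ i, |M (f i) i|) DFunLike.coe_injective.injOn]
  exact Finset.sum_le_sum_of_subset_of_nonneg (Finset.subset_univ _)
    fun f _ _ => Finset.prod_nonneg fun i _ => abs_nonneg _

/-- The vector `a` with an additional coordinate equal to one. -/
def homogenize {d : ℕ} (a : Fin d → ℕ) : Unit ⊕ Fin d → ℤ :=
  Sum.elim (fun _ => 1) fun i => (a i : ℤ)

/-- The maximal minors of homogenized lattice points of the simplex `∑ i, t i * x i ≤ 1`. -/
theorem abs_det_homogenize_le {d : ℕ} (t : Fin d → ℝ) (ht : ∀ i, 0 < t i)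
    (a : Unit ⊕ Fin d → Fin d → ℕ) (ha : ∀ j, ∑ i, t i * a j i ≤ 1) :
    |(((Matrix.of fun i j => homogenize (a j) i).det : ℤ) : ℝ)| ≤ ∏ i, (t i)⁻¹ := by
  set M : Matrix (Unit ⊕ Fin d) (Unit ⊕ Fin d) ℝ :=
    (Matrix.of fun i j => homogenize (a j) i).map (Int.castRingHom ℝ) with hM
  set L : Matrix (Unit ⊕ Fin d) (Unit ⊕ Fin d) ℝ :=
    Matrix.fromBlocks 1 (Matrix.of fun _ i => - t i) 0 (Matrix.diagonal t) with hL
  have hdetM : M.det = (((Matrix.of fun i j => homogenize (a j) i).det : ℤ) : ℝ) := by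
    rw [hM, ← RingHom.mapMatrix_apply, ← RingHom.map_det]
    simp
  have hdetL : L.det = ∏ i, t i := by
    rw [hL, Matrix.det_fromBlocks_zero₂₁, Matrix.det_one, one_mul, Matrix.det_diagonal]
  have hinl : ∀ j, (L * M) (Sum.inl ()) j = 1 - ∑ i, t i * a j i := by
    intro j
    simp [Matrix.mul_apply, hL, hM, homogenize, sub_eq_add_neg]
  have hinr : ∀ i j, (L * M) (Sum.inr i) j = t i * a j i := by
    intro i j
    simp [Matrix.mul_apply, hL, hM, homogenize, Matrix.diagonal_apply]
  have h1 : |(L * M).det| ≤ 1 := by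
    refine (abs_det_le_prod_sum_abs _).trans (Finset.prod_le_one (fun j _ => by positivity) ?_)
    intro j _
    rw [Fintype.sum_sum_type]
    simp only [Finset.univ_unique, PUnit.default_eq_unit, Finset.sum_singleton, hinl, hinr]
    rw [abs_of_nonneg (sub_nonneg.2 (ha j))]
    have : ∀ i, |t i * (a j i : ℝ)| = t i * a j i := fun i =>
      abs_of_nonneg (mul_nonneg (ht i).le (Nat.cast_nonneg _))
    simp [this]
  rw [Matrix.det_mul, hdetL, hdetM, abs_mul, abs_of_pos (Finset.prod_pos fun i _ => ht i)] at h1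
  rw [Finset.prod_inv_distrib, ← one_div, le_div_iff₀ (Finset.prod_pos fun i _ => ht i), mul_comm]
  exact h1

theorem span_homogenize_eq_top {n d : ℕ} (a : Fin n → Fin d → ℕ) (h0 : 0 ∈ Set.range a)
    (h1 : ∀ i, Pi.single i 1 ∈ Set.range a) :
    Submodule.span ℝ (Set.range fun j i => (homogenize (a j) i : ℝ)) = ⊤ := by
  set S := Submodule.span ℝ (Set.range fun j i => (homogenize (a j) i : ℝ))
  rw [eq_top_iff, ← (Pi.basisFun ℝ (Unit ⊕ Fin d)).span_eq, Submodule.span_le]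
  have hinl : (Pi.single (Sum.inl ()) 1 : Unit ⊕ Fin d → ℝ) ∈ S := by
    obtain ⟨j, hj⟩ := h0
    refine Submodule.subset_span ⟨j, ?_⟩
    ext i
    rcases i with i | i <;> simp [homogenize, hj]
  rintro _ ⟨i, rfl⟩
  rw [Pi.basisFun_apply]
  rcases i with i | i
  · exact hinl
  · obtain ⟨j, hj⟩ := h1 i
    have : (Pi.single (Sum.inr i) 1 : Unit ⊕ Fin d → ℝ) =
        (fun i' => (homogenize (a j) i' : ℝ)) - Pi.single (Sum.inl ()) 1 := by
      ext i'
      rcases i' with i' | i'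
      · simp [homogenize]
      · simp [homogenize, hj, Pi.single_apply]
    rw [this]
    exact S.sub_mem (Submodule.subset_span ⟨j, rfl⟩) hinl

theorem natComb_homogenize {n d : ℕ} (a : Fin n → Fin d → ℕ) (l : Fin n → ℕ) :
    natComb (fun j => homogenize (a j)) l =
      Sum.elim (fun _ => ((∑ j, l j : ℕ) : ℤ)) fun i => (natComb a l i : ℤ) := by
  ext i
  rcases i with i | i <;> simp [natComb_apply, homogenize]

/-- Effective Khovanskii theorem for lattice points of the simplex `∑ i, t i * x i ≤ 1`. -/
theorem exists_polynomial_ncard_sumset {n d : ℕ} (a : Fin n → Fin d → ℕ)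
    (h0 : 0 ∈ Set.range a) (h1 : ∀ i, Pi.single i 1 ∈ Set.range a)
    (t : Fin d → ℝ) (ht : ∀ i, 0 < t i) (ha : ∀ j, ∑ i, t i * a j i ≤ 1) :
    ∃ q : Polynomial ℚ, ∀ k : ℕ, (n : ℝ) ^ 2 * ∏ i, (t i)⁻¹ - n + 1 ≤ k →
      (((natComb a '' {l | ∑ j, l j = k}).ncard : ℕ) : ℚ) = q.eval (k : ℚ) := by
  obtain ⟨q, hq⟩ := exists_polynomial_ncard_natComb (fun j => homogenize (a j)) (Sum.inl ())
    (fun j => rfl) (span_homogenize_eq_top a h0 h1) (∏ i, (t i)⁻¹)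
    (Finset.prod_nonneg fun i _ => (inv_pos.2 (ht i)).le)
    (fun σ => abs_det_homogenize_le t ht (fun j => a (σ j)) fun j => ha (σ j))
  refine ⟨q, fun k hk => ?_⟩
  rw [← hq k hk]
  have himg : natComb (fun j => homogenize (a j)) '' {l | ∑ j, l j = k} =
      (fun x : Fin d → ℕ => Sum.elim (fun _ : Unit => (k : ℤ)) fun i => (x i : ℤ)) ''
        (natComb a '' {l | ∑ j, l j = k}) := by
    rw [Set.image_image]
    refine Set.image_congr fun l hl => ?_
    rw [natComb_homogenize, hl]
  have hinj : Function.Injective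
      fun x : Fin d → ℕ => Sum.elim (fun _ : Unit => (k : ℤ)) fun i => (x i : ℤ) := by
    intro x y hxy
    ext i
    simpa using congrFun hxy (Sum.inr i)
  rw [himg, Set.ncard_image_of_injective _ hinj]

theorem mem_convexHull_range_iff {ι E : Type*} [Fintype ι] [AddCommGroup E] [Module ℝ E]
    (v : ι → E) (x : E) :
    x ∈ convexHull ℝ (Set.range v) ↔
      ∃ w : ι → ℝ, (∀ j, 0 ≤ w j) ∧ ∑ j, w j = 1 ∧ ∑ j, w j • v j = x := by
  classical
  constructor
  · rw [convexHull_range_eq_exists_affineCombination]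
    rintro ⟨s, w, hw0, hw1, rfl⟩
    refine ⟨fun j => if j ∈ s then w j else 0, fun j => ?_, by simpa using hw1, ?_⟩
    · dsimp only
      split_ifs with h
      exacts [hw0 j h, le_rfl]
    · rw [Finset.affineCombination_eq_linear_combination _ _ _ hw1]
      simp
  · rintro ⟨w, hw0, hw1, rfl⟩
    exact (convex_convexHull ℝ _).sum_mem (fun j _ => hw0 j) hw1
      fun j _ => subset_convexHull ℝ _ ⟨j, rfl⟩

section Asymptotics

variable {n d : ℕ} (a : Fin n → Fin d → ℕ)

/-- The convex hull of the points `a j` in `ℝ^d`. -/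
def latticeHull : Set (Fin d → ℝ) := convexHull ℝ (Set.range fun j i => (a j i : ℝ))

theorem isCompact_latticeHull : IsCompact (latticeHull a) :=
  (Set.finite_range _).isCompact_convexHull ℝ

theorem latticeHull_nonneg {x : Fin d → ℝ} (hx : x ∈ latticeHull a) (i : Fin d) : 0 ≤ x i := by
  obtain ⟨w, hw0, -, rfl⟩ := (mem_convexHull_range_iff _ _).1 hx
  simp only [Finset.sum_apply, Pi.smul_apply, smul_eq_mul]
  exact Finset.sum_nonneg fun j _ => mul_nonneg (hw0 j) (Nat.cast_nonneg _)

/-- The lattice points of the `m`-th dilate of the hull. -/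
def dilatePoints (m : ℕ) : Set (Fin d → ℕ) := {x | (fun i => (x i : ℝ) / m) ∈ latticeHull a}

theorem card_latticeHull_inter {m : ℕ} (hm : m ≠ 0) :
    Nat.card ↑(latticeHull a ∩
      (m : ℝ)⁻¹ • (Submodule.span ℤ (Set.range (Pi.basisFun ℝ (Fin d))) : Set (Fin d → ℝ))) =
      (dilatePoints a m).ncard := by
  have hm' : (m : ℝ) ≠ 0 := by exact_mod_cast hm
  have himg : latticeHull a ∩
      (m : ℝ)⁻¹ • (Submodule.span ℤ (Set.range (Pi.basisFun ℝ (Fin d))) : Set (Fin d → ℝ)) =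
      (fun (x : Fin d → ℕ) i => (x i : ℝ) / m) '' dilatePoints a m := by
    ext y
    constructor
    · rintro ⟨hy, z, hz, rfl⟩
      rw [SetLike.mem_coe, Module.Basis.mem_span_iff_repr_mem] at hz
      choose f hf using hz
      have hf' : ∀ i, (f i : ℝ) = z i := fun i => by simpa using hf i
      have hnn : ∀ i, 0 ≤ f i := fun i => by
        have h1 := latticeHull_nonneg a hy i
        simp only [Pi.smul_apply, smul_eq_mul, ← hf'] at h1
        have h2 : 0 < (m : ℝ)⁻¹ := by positivity
        exact_mod_cast nonneg_of_mul_nonneg_right h1 h2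
      have hcast : (fun i => (((f i).toNat : ℕ) : ℝ) / m) = (m : ℝ)⁻¹ • z := by
        ext i
        have h3 : (((f i).toNat : ℕ) : ℝ) = f i := by exact_mod_cast Int.toNat_of_nonneg (hnn i)
        rw [h3, hf', Pi.smul_apply, smul_eq_mul, div_eq_inv_mul]
      refine ⟨fun i => (f i).toNat, ?_, hcast⟩
      simp only [dilatePoints, Set.mem_ofPred_eq, hcast]
      exact hy
    · rintro ⟨x, hx, rfl⟩
      refine ⟨hx, fun i => (x i : ℝ), ?_, ?_⟩
      · rw [SetLike.mem_coe, Module.Basis.mem_span_iff_repr_mem]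
        exact fun i => ⟨x i, by simp⟩
      · ext i
        simp [div_eq_inv_mul]
  rw [himg, Nat.card_coe_set_eq, Set.ncard_image_of_injective]
  intro x y hxy
  ext i
  have := congrFun hxy i
  simpa [hm'] using this

theorem finite_dilatePoints {m : ℕ} (hm : m ≠ 0) : (dilatePoints a m).Finite := by
  have hm' : (0 : ℝ) < m := by exact_mod_cast Nat.pos_of_ne_zero hm
  obtain ⟨R, hR⟩ := (isCompact_latticeHull a).isBounded.exists_norm_le
  refine (Set.finite_Iic fun _ : Fin d => ⌊R * m⌋₊).subset fun x hx i => Nat.le_floor ?_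
  rw [← div_le_iff₀ hm']
  exact (le_abs_self _).trans ((norm_le_pi_norm _ i).trans (hR _ hx))

theorem tendsto_ncard_dilatePoints_div_pow :
    Filter.Tendsto (fun m : ℕ => ((dilatePoints a m).ncard : ℝ) / m ^ d) Filter.atTop
      (nhds (volume.real (latticeHull a))) := by
  have h := tendsto_card_div_pow_atTop_volume (latticeHull a) (isCompact_latticeHull a).isBounded
    (isCompact_latticeHull a).measurableSet ((convex_convexHull ℝ _).addHaar_frontier _)
  rw [Fintype.card_fin] at h
  refine h.congr' ?_
  filter_upwards [Filter.eventually_ne_atTop 0] with m hm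
  rw [card_latticeHull_inter a hm]

theorem sumset_subset_dilatePoints {k : ℕ} (hk : k ≠ 0) :
    natComb a '' {l | ∑ j, l j = k} ⊆ dilatePoints a k := by
  have hk' : (k : ℝ) ≠ 0 := by exact_mod_cast hk
  rintro _ ⟨l, hl, rfl⟩
  refine (mem_convexHull_range_iff _ _).2 ⟨fun j => l j / k, fun j => by positivity, ?_, ?_⟩
  · rw [← Finset.sum_div, ← Nat.cast_sum, hl, div_self hk']
  · ext i
    simp only [natComb_apply, Finset.sum_apply, Pi.smul_apply, smul_eq_mul, Nat.cast_sum,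
      Nat.cast_mul, Finset.sum_div]
    exact Finset.sum_congr rfl fun j _ => by ring

theorem dilatePoints_subset_sumset (h0 : 0 ∈ Set.range a)
    (h1 : ∀ i, Pi.single i 1 ∈ Set.range a) {m : ℕ} (hm : m ≠ 0) :
    dilatePoints a m ⊆ natComb a '' {l | ∑ j, l j = m + ∑ i, ∑ j, a j i} := by
  classical
  have hm' : (m : ℝ) ≠ 0 := by exact_mod_cast hm
  intro x hx
  obtain ⟨w, hw0, hw1, hwx⟩ := (mem_convexHull_range_iff _ _).1 hx
  obtain ⟨j₀, hj₀⟩ := h0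
  choose e he using h1
  set l : Fin n → ℕ := fun j => ⌊m * w j⌋₊ with hl
  have hmw : ∀ j, 0 ≤ m * w j := fun j => mul_nonneg (Nat.cast_nonneg _) (hw0 j)
  have hl1 : ∀ j, (l j : ℝ) ≤ m * w j := fun j => Nat.floor_le (hmw j)
  have hl2 : ∀ j, m * w j ≤ l j + 1 := fun j => (Nat.lt_floor_add_one _).le
  have hxi : ∀ i, (x i : ℝ) = ∑ j, m * w j * a j i := by
    intro i
    have := congrFun hwx i
    simp only [Finset.sum_apply, Pi.smul_apply, smul_eq_mul] at this
    rw [eq_div_iff hm', mul_comm, Finset.mul_sum] at this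
    rw [← this]
    exact Finset.sum_congr rfl fun j _ => by ring
  have hle : natComb a l ≤ x := by
    intro i
    have : ((natComb a l i : ℕ) : ℝ) ≤ x i := by
      rw [hxi, natComb_apply]
      simp only [Finset.sum_apply, Pi.smul_apply, smul_eq_mul, Nat.cast_sum, Nat.cast_mul]
      exact Finset.sum_le_sum fun j _ => mul_le_mul_of_nonneg_right (hl1 j) (Nat.cast_nonneg _)
    exact_mod_cast this
  set r : Fin d → ℕ := x - natComb a l with hr
  have hxr : natComb a l + r = x := add_tsub_cancel_of_le hle
  have hri : ∀ i, r i ≤ ∑ j, a j i := by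
    intro i
    have h2 : natComb a l i + r i = x i := congrFun hxr i
    have : (x i : ℝ) ≤ ((natComb a l i + ∑ j, a j i : ℕ) : ℝ) := by
      rw [hxi, natComb_apply]
      simp only [Finset.sum_apply, Pi.smul_apply, smul_eq_mul, Nat.cast_add, Nat.cast_sum,
        Nat.cast_mul, ← Finset.sum_add_distrib]
      refine Finset.sum_le_sum fun j _ => ?_
      nlinarith [hl2 j, (Nat.cast_nonneg (a j i) : (0 : ℝ) ≤ a j i)]
    have : x i ≤ natComb a l i + ∑ j, a j i := by exact_mod_cast this
    omega
  have hsum : ∑ j, l j + ∑ i, r i ≤ m + ∑ i, ∑ j, a j i := by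
    refine add_le_add ?_ (Finset.sum_le_sum fun i _ => hri i)
    have : ((∑ j, l j : ℕ) : ℝ) ≤ m := by
      rw [Nat.cast_sum]
      refine (Finset.sum_le_sum fun j _ => hl1 j).trans ?_
      rw [← Finset.mul_sum, hw1, mul_one]
    exact_mod_cast this
  have hsingle : ∀ (j : Fin n) (c : ℕ), natComb a (Pi.single j c) = c • a j := by
    intro j c
    rw [natComb_apply, Finset.sum_eq_single j] <;> simp +contextual
  refine ⟨l + ∑ i, Pi.single (e i) (r i) +
    Pi.single j₀ (m + ∑ i, ∑ j, a j i - (∑ j, l j + ∑ i, r i)), ?_, ?_⟩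
  · have h3 : ∑ j, (∑ i, Pi.single (e i) (r i) : Fin n → ℕ) j = ∑ i, r i := by
      simp only [Finset.sum_apply]
      rw [Finset.sum_comm]
      exact Finset.sum_congr rfl fun i _ => by simp
    simp only [Set.mem_ofPred_eq, Pi.add_apply, Finset.sum_add_distrib, h3]
    rw [Finset.sum_pi_single']
    simp only [Finset.mem_univ, if_true]
    omega
  · rw [map_add, map_add, map_sum]
    simp only [hsingle, he, hj₀, smul_zero, add_zero]
    rw [← hxr]
    congr 1
    ext i
    simp [Pi.single_apply]

/-- The sumsets of a family containing zero and the unit vectors grow like the volume of its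
hull. -/
theorem tendsto_ncard_sumset_div_pow (h0 : 0 ∈ Set.range a)
    (h1 : ∀ i, Pi.single i 1 ∈ Set.range a) :
    Filter.Tendsto (fun k : ℕ => ((natComb a '' {l | ∑ j, l j = k}).ncard : ℝ) / k ^ d)
      Filter.atTop (nhds (volume.real (latticeHull a))) := by
  set C := ∑ i, ∑ j, a j i with hC
  have hup := tendsto_ncard_dilatePoints_div_pow a
  have hratio : Filter.Tendsto (fun k : ℕ => (k : ℝ) / ((k + C : ℕ) : ℝ)) Filter.atTop (nhds 1) := by
    simpa using tendsto_natCast_div_add_atTop (𝕜 := ℝ) (C : ℝ)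
  have hlow : Filter.Tendsto (fun k : ℕ => ((dilatePoints a k).ncard : ℝ) / ((k + C : ℕ) : ℝ) ^ d)
      Filter.atTop (nhds (volume.real (latticeHull a))) := by
    have := hup.mul (hratio.pow d)
    rw [one_pow, mul_one] at this
    refine this.congr' ?_
    filter_upwards [Filter.eventually_ne_atTop 0] with k hk
    have hk' : (k : ℝ) ≠ 0 := by exact_mod_cast hk
    rw [div_pow]
    field_simp
  rw [← Filter.tendsto_add_atTop_iff_nat C]
  refine tendsto_of_tendsto_of_tendsto_of_le_of_le' hlow
    ((Filter.tendsto_add_atTop_iff_nat C).2 hup) ?_ ?_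
  · filter_upwards [Filter.eventually_ne_atTop 0] with k hk
    have hfin := (finite_dilatePoints a (m := k + C) (by omega)).subset
      (sumset_subset_dilatePoints a (k := k + C) (by omega))
    gcongr
    exact dilatePoints_subset_sumset a h0 h1 hk
  · filter_upwards [Filter.eventually_ne_atTop 0] with k hk
    gcongr
    · exact finite_dilatePoints a (by omega)
    · exact sumset_subset_dilatePoints a (by omega)

theorem volume_latticeHull_pos (h0 : 0 ∈ Set.range a) (h1 : ∀ i, Pi.single i 1 ∈ Set.range a) :
    0 < volume.real (latticeHull a) := by
  classical
  obtain ⟨j₀, hj₀⟩ := h0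
  choose e he using h1
  have hsub : Set.Icc (0 : Fin d → ℝ) (fun _ => (d : ℝ)⁻¹) ⊆ latticeHull a := by
    rintro x ⟨hx0, hx1⟩
    have hs : ∑ i, x i ≤ 1 := by
      refine (Finset.sum_le_sum fun i _ => hx1 i).trans ?_
      simp only [Finset.sum_const, Finset.card_univ, Fintype.card_fin, nsmul_eq_mul]
      exact mul_inv_le_one
    have hx : x = ∑ o : Option (Fin d), (o.elim (1 - ∑ i, x i) x) •
        (fun i => (a (o.elim j₀ e) i : ℝ)) := by
      ext i
      simp [Fintype.sum_option, hj₀, he, Pi.single_apply]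
    rw [hx]
    refine (convex_convexHull ℝ _).sum_mem ?_ ?_ ?_
    · rintro (_ | i) -
      · simpa using hs
      · exact hx0 i
    · simp [Fintype.sum_option]
    · exact fun o _ => subset_convexHull ℝ _ ⟨_, rfl⟩
  have hfin : volume (latticeHull a) ≠ ⊤ := (isCompact_latticeHull a).measure_lt_top.ne
  refine lt_of_lt_of_le ?_ (measureReal_mono hsub hfin)
  rw [measureReal_def, Real.volume_Icc_pi, ENNReal.toReal_prod]
  refine Finset.prod_pos fun i _ => ?_
  have : 0 < d := i.pos
  rw [Pi.zero_apply, sub_zero, ENNReal.toReal_ofReal (by positivity)]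
  positivity

end Asymptotics

/-- A rational polynomial equivalent to `V * k ^ d` with `V > 0` has degree `d` and leading
coefficient `V`. -/
theorem degree_and_leadingCoeff_of_tendsto (q : Polynomial ℚ) (d : ℕ) (V : ℝ) (hV : 0 < V)
    (h : Filter.Tendsto (fun k : ℕ => ((q.eval (k : ℚ) : ℚ) : ℝ) / (k : ℝ) ^ d) Filter.atTop
      (nhds V)) :
    q.degree = d ∧ (q.leadingCoeff : ℝ) = V := by
  set p : Polynomial ℝ := q.map (Rat.castHom ℝ) with hp
  have hpe : ∀ k : ℕ, p.eval (k : ℝ) = ((q.eval (k : ℚ) : ℚ) : ℝ) := by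
    simp [hp]
  simp only [← hpe] at h
  have hX : ∀ k : ℕ, (k : ℝ) ^ d = (Polynomial.X ^ d : Polynomial ℝ).eval (k : ℝ) := by simp
  simp only [hX] at h
  have hdeg : (Polynomial.X ^ d : Polynomial ℝ).degree = d := Polynomial.degree_X_pow d
  have hpd : p.degree = q.degree := Polynomial.degree_map _ _
  have hpl : p.leadingCoeff = (q.leadingCoeff : ℝ) := by
    rw [hp, Polynomial.leadingCoeff_map]; rfl
  rw [← hpd, ← hpl]
  rcases lt_trichotomy p.degree (d : WithBot ℕ) with hlt | heq | hgt
  · rw [← hdeg] at hlt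
    have := (Polynomial.div_tendsto_atTop_zero_of_degree_lt p _ hlt).comp tendsto_natCast_atTop_atTop
    exact absurd (tendsto_nhds_unique h this) hV.ne'
  · refine ⟨heq, ?_⟩
    rw [← hdeg] at heq
    have := (Polynomial.div_tendsto_atTop_leadingCoeff_div_of_degree_eq p _ heq).comp
      tendsto_natCast_atTop_atTop
    rw [Polynomial.leadingCoeff_X_pow, div_one] at this
    exact (tendsto_nhds_unique h this).symm
  · rw [← hdeg] at hgt
    have := (Polynomial.abs_div_tendsto_atTop_atTop_of_degree_gt p _ hgt (by simp)).comp
      tendsto_natCast_atTop_atTop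
    exact absurd h.abs (not_tendsto_nhds_of_tendsto_atTop this _)

/-- The vertices of the standard simplex with a vertex at the origin. -/
def unitSimplexVertices (d : ℕ) : Fin (d + 1) → Fin d → ℕ := Fin.cons 0 fun i => Pi.single i 1

theorem mem_latticeHull_unitSimplexVertices {d : ℕ} {x : Fin d → ℝ} (hx0 : ∀ i, 0 ≤ x i)
    (hx1 : ∑ i, x i ≤ 1) : x ∈ latticeHull (unitSimplexVertices d) := by
  refine (mem_convexHull_range_iff _ _).2 ⟨Fin.cons (1 - ∑ i, x i) x, ?_, ?_, ?_⟩
  · refine Fin.cases (by simpa using hx1) fun i => ?_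
    simpa using hx0 i
  · simp [Fin.sum_univ_succ]
  · ext i
    simp [Fin.sum_univ_succ, unitSimplexVertices, Pi.single_apply]

theorem volume_latticeHull_unitSimplexVertices_le (d : ℕ) :
    volume.real (latticeHull (unitSimplexVertices d)) ≤ 1 / (d.factorial : ℝ) := by
  have hlim := tendsto_ncard_sumset_div_pow (unitSimplexVertices d) ⟨0, rfl⟩ fun i => ⟨i.succ, rfl⟩
  have hratio : Filter.Tendsto (fun k : ℕ => 1 / (d.factorial : ℝ) * (((k : ℝ) + d) / k) ^ d)
      Filter.atTop (nhds (1 / (d.factorial : ℝ))) := by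
    have h := (tendsto_natCast_div_add_atTop (𝕜 := ℝ) (d : ℝ)).inv₀ one_ne_zero
    simpa using (h.pow d).const_mul (1 / (d.factorial : ℝ))
  refine le_of_tendsto_of_tendsto' hlim hratio fun k => ?_
  have hset : {l : Fin (d + 1) → ℕ | ∑ j, l j = k} =
      (Finset.piAntidiag Finset.univ k : Finset (Fin (d + 1) → ℕ)) := by
    ext l
    simp
  have hcount : (natComb (unitSimplexVertices d) '' {l | ∑ j, l j = k}).ncard ≤
      (k + d).choose d := by
    rw [hset]
    refine (Set.ncard_image_le (Finset.finite_toSet _)).trans ?_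
    rw [Set.ncard_coe_finset, ← Finset.map_sym_eq_piAntidiag, Finset.card_map,
      Finset.sym_univ, Finset.card_univ, Sym.card_sym_eq_choose, Fintype.card_fin,
      show d + 1 + k - 1 = k + d by omega, Nat.choose_symm_add]
  have hchoose : ((k + d).choose d : ℝ) ≤ 1 / (d.factorial : ℝ) * ((k : ℝ) + d) ^ d := by
    have := Nat.choose_le_pow_div (α := ℝ) d (k + d)
    push_cast at this
    rwa [one_div_mul_eq_div]
  rw [div_pow, ← mul_div_assoc]
  gcongr
  exact le_trans (by exact_mod_cast hcount) hchoose

/-- The hull of a family whose members `x` satisfy `∑ i, t i * x i ≤ 1` is contained in a simplex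
of volume `(∏ i, (t i)⁻¹) / d!`. -/
theorem volume_latticeHull_le {n d : ℕ} (a : Fin n → Fin d → ℕ) (t : Fin d → ℝ)
    (ht : ∀ i, 0 < t i) (ha : ∀ j, ∑ i, t i * a j i ≤ 1) :
    volume.real (latticeHull a) ≤ 1 / (d.factorial : ℝ) * ∏ i, (t i)⁻¹ := by
  classical
  set T : (Fin d → ℝ) →ₗ[ℝ] (Fin d → ℝ) := Matrix.toLin' (Matrix.diagonal t) with hT
  have hdet : LinearMap.det T = ∏ i, t i := by rw [hT, LinearMap.det_toLin', Matrix.det_diagonal]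
  have hpos : 0 < ∏ i, t i := Finset.prod_pos fun i _ => ht i
  have hTx : ∀ x i, T x i = t i * x i := fun x i => by
    rw [hT, Matrix.toLin'_apply, Matrix.mulVec_diagonal]
  have hsub : latticeHull a ⊆ T ⁻¹' latticeHull (unitSimplexVertices d) := by
    intro x hx
    refine mem_latticeHull_unitSimplexVertices (fun i => ?_) ?_
    · rw [hTx]
      exact mul_nonneg (ht i).le (latticeHull_nonneg a hx i)
    · obtain ⟨w, hw0, hw1, rfl⟩ := (mem_convexHull_range_iff _ _).1 hx
      simp only [hTx, Finset.sum_apply, Pi.smul_apply, smul_eq_mul, Finset.mul_sum]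
      rw [Finset.sum_comm]
      calc ∑ j, ∑ i, t i * (w j * a j i) = ∑ j, w j * ∑ i, t i * a j i := by
            simp only [Finset.mul_sum]
            exact Finset.sum_congr rfl fun j _ => Finset.sum_congr rfl fun i _ => by ring
        _ ≤ ∑ j, w j * 1 := Finset.sum_le_sum fun j _ => mul_le_mul_of_nonneg_left (ha j) (hw0 j)
        _ = 1 := by simpa using hw1
  have hpre : volume.real (T ⁻¹' latticeHull (unitSimplexVertices d)) =
      (∏ i, t i)⁻¹ * volume.real (latticeHull (unitSimplexVertices d)) := by
    rw [measureReal_def, Measure.addHaar_preimage_linearMap _ (by rw [hdet]; exact hpos.ne'),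
      hdet, ENNReal.toReal_mul, ENNReal.toReal_ofReal (abs_nonneg _),
      abs_of_pos (inv_pos.2 hpos), measureReal_def]
  have hfin : volume (T ⁻¹' latticeHull (unitSimplexVertices d)) ≠ ⊤ := by
    rw [Measure.addHaar_preimage_linearMap _ (by rw [hdet]; exact hpos.ne')]
    exact ENNReal.mul_ne_top ENNReal.ofReal_ne_top (isCompact_latticeHull _).measure_lt_top.ne
  refine (measureReal_mono hsub hfin).trans ?_
  rw [hpre, mul_comm, Finset.prod_inv_distrib]
  exact mul_le_mul_of_nonneg_right (volume_latticeHull_unitSimplexVertices_le d)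
    (inv_pos.2 hpos).le

/-- The product of the first `d` primes raised to the powers `x i`. -/
noncomputable def primePowProd {d : ℕ} (x : Fin d → ℕ) : ℕ := ∏ i : Fin d, Nat.nth Nat.Prime i ^ x i

theorem primePowProd_pos {d : ℕ} (x : Fin d → ℕ) : 0 < primePowProd x :=
  Finset.prod_pos fun i _ => pow_pos (Nat.prime_nth_prime i).pos _

theorem factorization_primePowProd {d : ℕ} (x : Fin d → ℕ) (i : Fin d) :
    (primePowProd x).factorization (Nat.nth Nat.Prime i) = x i := by
  have hinj : ∀ j : Fin d, Nat.nth Nat.Prime j = Nat.nth Nat.Prime i ↔ j = i := fun j => by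
    rw [(Nat.nth_injective Nat.infinite_setOfPred_prime).eq_iff, Fin.ext_iff]
  have hne : ∀ j ∈ (Finset.univ : Finset (Fin d)), Nat.nth Nat.Prime j ^ x j ≠ 0 := fun j _ =>
    (pow_pos (Nat.prime_nth_prime j).pos _).ne'
  rw [primePowProd, Nat.factorization_prod hne, Finsupp.finsetSum_apply]
  simp [Finsupp.single_apply, hinj]

theorem primePowProd_injective {d : ℕ} :
    Function.Injective (primePowProd : (Fin d → ℕ) → ℕ) := fun x y h => by
  ext i
  rw [← factorization_primePowProd x, h, factorization_primePowProd]

theorem primePowProd_natComb {n d : ℕ} (a : Fin n → Fin d → ℕ) (l : Fin n → ℕ) :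
    primePowProd (natComb a l) = ∏ j, primePowProd (a j) ^ l j := by
  simp only [primePowProd, natComb_apply, Finset.sum_apply, Pi.smul_apply, smul_eq_mul,
    ← Finset.prod_pow, ← pow_mul]
  rw [Finset.prod_comm]
  simp only [Finset.prod_pow_eq_pow_sum, mul_comm]

theorem nth_prime_le_of_lt_primeCounting {n i : ℕ} (hi : i < Nat.primeCounting n) :
    Nat.nth Nat.Prime i ≤ n :=
  Nat.lt_succ_iff.1 (Nat.nth_lt_of_lt_count hi)

/-- The exponent vectors of `1, ..., n` with respect to the primes at most `n`. -/
noncomputable def exponentVector (n : ℕ) (j : Fin n) (i : Fin (Nat.primeCounting n)) : ℕ :=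
  ((j : ℕ) + 1).factorization (Nat.nth Nat.Prime i)

theorem primePowProd_exponentVector (n : ℕ) (j : Fin n) :
    primePowProd (exponentVector n j) = j + 1 := by
  have hsub : ((j : ℕ) + 1).factorization.support ⊆
      Finset.univ.image fun i : Fin (Nat.primeCounting n) => Nat.nth Nat.Prime i := by
    intro p hp
    have hprime := Nat.prime_of_mem_primeFactors (Nat.support_factorization _ ▸ hp)
    have hle := Nat.le_of_mem_primeFactors (Nat.support_factorization _ ▸ hp)
    refine Finset.mem_image.2 ⟨⟨Nat.count Nat.Prime p, ?_⟩, Finset.mem_univ _,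
      Nat.nth_count hprime⟩
    exact Nat.count_strict_mono hprime (by omega)
  have hprod := Nat.prod_factorization_pow_eq_self (Nat.add_one_ne_zero (j : ℕ))
  rwa [Finsupp.prod_of_support_subset _ hsub _ (by simp), Finset.prod_image fun i _ k _ h =>
    Fin.ext (Nat.nth_injective Nat.infinite_setOfPred_prime h)] at hprod

theorem exponentVector_eq_of_primePowProd_eq {n : ℕ} {x : Fin (Nat.primeCounting n) → ℕ}
    {j : Fin n} (h : primePowProd x = j + 1) : exponentVector n j = x :=
  primePowProd_injective ((primePowProd_exponentVector n j).trans h.symm)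

theorem range_exponentVector (n : ℕ) : Set.range (exponentVector n) = Mn n := by
  ext x
  constructor
  · rintro ⟨j, rfl⟩
    exact (primePowProd_exponentVector n j).le.trans j.2
  · intro hx
    have hpos := primePowProd_pos x
    have hle : primePowProd x ≤ n := hx
    exact ⟨⟨primePowProd x - 1, by omega⟩, exponentVector_eq_of_primePowProd_eq (by simp; omega)⟩

theorem zero_mem_Mn {n : ℕ} (hn : 1 ≤ n) : 0 ∈ Mn n := by
  simpa [Mn] using hn

theorem single_mem_Mn {n : ℕ} (i : Fin (Nat.primeCounting n)) : Pi.single i 1 ∈ Mn n := by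
  have h : ∏ j : Fin (Nat.primeCounting n), Nat.nth Nat.Prime j ^ (Pi.single i 1 : _ → ℕ) j =
      Nat.nth Nat.Prime i := by
    rw [Finset.prod_eq_single i] <;> simp +contextual
  rw [Mn, Set.mem_ofPred_eq, h]
  exact nth_prime_le_of_lt_primeCounting i.2

theorem latticeHull_exponentVector (n : ℕ) : latticeHull (exponentVector n) = Qn n := by
  rw [latticeHull, Qn, ← range_exponentVector, ← Set.range_comp]
  rfl

theorem ncard_Pset (k n : ℕ) :
    (Pset k n).ncard = (natComb (exponentVector n) '' {l | ∑ j, l j = k}).ncard := by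
  rw [← Set.ncard_image_of_injective _ primePowProd_injective]
  congr 1
  ext m
  simp [Pset, primePowProd_natComb, primePowProd_exponentVector]

theorem sum_log_div_mul_exponentVector_le {n : ℕ} (hn : 2 ≤ n) (j : Fin n) :
    ∑ i : Fin (Nat.primeCounting n),
      Real.log (Nat.nth Nat.Prime i) / Real.log n * exponentVector n j i ≤ 1 := by
  have hlog : 0 < Real.log n := Real.log_pos (by exact_mod_cast hn)
  have hsum : ∑ i : Fin (Nat.primeCounting n),
      exponentVector n j i * Real.log (Nat.nth Nat.Prime i) = Real.log ((j : ℕ) + 1 : ℕ) := by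
    rw [← primePowProd_exponentVector, primePowProd, Nat.cast_prod, Real.log_prod]
    · simp
    · exact fun i _ => by exact_mod_cast (pow_pos (Nat.prime_nth_prime i).pos _).ne'
  calc _ = (∑ i : Fin (Nat.primeCounting n),
      exponentVector n j i * Real.log (Nat.nth Nat.Prime i)) / Real.log n := by
        rw [Finset.sum_div]
        exact Finset.sum_congr rfl fun i _ => by ring
    _ ≤ 1 := by
        rw [hsum, div_le_one hlog]
        exact Real.log_le_log (by positivity) (by exact_mod_cast j.2)

theorem stmt11 (n : ℕ) (hn : 2 ≤ n) :
    ∃ q : Polynomial ℚ, q.degree = Nat.primeCounting n ∧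
      (∀ k : ℕ,
        (n : ℝ) ^ 2 * (∏ m : Fin (Nat.primeCounting n),
            Real.log n / Real.log (Nat.nth Nat.Prime (m : ℕ))) - n + 1 ≤ k →
        ((Pset k n).ncard : ℚ) = q.eval (k : ℚ)) ∧
      (q.leadingCoeff : ℝ) = (volume (Qn n)).toReal ∧
      (volume (Qn n)).toReal ≤
        (1 / ((Nat.primeCounting n).factorial : ℝ)) *
          ∏ j : Fin (Nat.primeCounting n),
            Real.log n / Real.log (Nat.nth Nat.Prime (j : ℕ)) := by
  set t : Fin (Nat.primeCounting n) → ℝ := fun i =>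
    Real.log (Nat.nth Nat.Prime i) / Real.log n with ht
  have ht0 : ∀ i, 0 < t i := fun i => div_pos
    (Real.log_pos (by exact_mod_cast (Nat.prime_nth_prime i).one_lt))
    (Real.log_pos (by exact_mod_cast hn))
  have htinv : ∀ i : Fin (Nat.primeCounting n),
      Real.log n / Real.log (Nat.nth Nat.Prime i) = (t i)⁻¹ := fun i => (inv_div _ _).symm
  have ha := sum_log_div_mul_exponentVector_le hn
  have h0 : 0 ∈ Set.range (exponentVector n) := by
    rw [range_exponentVector]
    exact zero_mem_Mn (by omega)
  have h1 : ∀ i, Pi.single i 1 ∈ Set.range (exponentVector n) := fun i => by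
    rw [range_exponentVector]
    exact single_mem_Mn i
  simp only [htinv, ← latticeHull_exponentVector, ncard_Pset, ← measureReal_def]
  obtain ⟨q, hq⟩ := exists_polynomial_ncard_sumset (exponentVector n) h0 h1 t ht0 ha
  have hlim : Filter.Tendsto
      (fun k : ℕ => ((q.eval (k : ℚ) : ℚ) : ℝ) / (k : ℝ) ^ Nat.primeCounting n) Filter.atTop
      (nhds (volume.real (latticeHull (exponentVector n)))) := by
    refine (tendsto_ncard_sumset_div_pow (exponentVector n) h0 h1).congr' ?_
    filter_upwards [tendsto_natCast_atTop_atTop.eventually_ge_atTop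
      ((n : ℝ) ^ 2 * ∏ i, (t i)⁻¹ - n + 1)] with k hk
    rw [← hq k hk, Rat.cast_natCast]
  obtain ⟨hdeg, hlead⟩ := degree_and_leadingCoeff_of_tendsto q _ _
    (volume_latticeHull_pos _ h0 h1) hlim
  exact ⟨q, hdeg, hq, hlead, volume_latticeHull_le _ t ht0 ha⟩
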